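/- arXiv:2212.13608 — 6 statements merged into one kernel-verified Lean document; each statement's English description precedes it below -/
import Mathlib

section
/- Let M be a module over a commutative ring and let d, Δ, θ : M → M be linear maps satisfying d∘d = 0, Δ∘Δ = 0, d∘Δ + Δ∘d = 0, and θ∘Δ + Δ∘θ = id. Then the map D := θ∘Δ∘d satisfies D∘D = 0. -/
/-- If `d`, `Δ`, `θ` are linear endomorphisms of a module `M` over a commutative ring `R`
with `d ∘ d = 0`, `Δ ∘ Δ = 0`, `d ∘ Δ + Δ ∘ d = 0` and `θ ∘ Δ + Δ ∘ θ = id`,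
then `D := θ ∘ Δ ∘ d` satisfies `D ∘ D = 0`. -/
theorem stmt0 {R M : Type*} [CommRing R] [AddCommGroup M] [Module R M]
    (d Δ θ : Module.End R M)
    (hd : d * d = 0) (hΔ : Δ * Δ = 0)
    (hdΔ : d * Δ + Δ * d = 0) (hθΔ : θ * Δ + Δ * θ = 1) :
    (θ * Δ * d) * (θ * Δ * d) = 0 := by
  have h₁ : θ * Δ = 1 - Δ * θ := eq_sub_of_add_eq hθΔ
  have h₂ : Δ * d * Δ = 0 := by
    rw [mul_assoc, eq_neg_of_add_eq_zero_left hdΔ, mul_neg, ← mul_assoc, hΔ, zero_mul, neg_zero]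
  calc (θ * Δ * d) * (θ * Δ * d) = θ * Δ * d * ((θ * Δ) * d) := rfl
    _ = θ * Δ * d * ((1 - Δ * θ) * d) := by rw [← h₁]
    _ = θ * Δ * (d * d) - θ * (Δ * d * Δ) * θ * d := by noncomm_ring
    _ = 0 := by rw [hd, h₂]; simp
end

section
/- Let M be a module over a commutative ring and let d, Δ, θ : M → M be linear maps satisfying d∘d = 0, Δ∘Δ = 0, d∘Δ + Δ∘d = 0, and θ∘Δ + Δ∘θ = id. Then for every x ∈ range(θ∘Δ), d(Δx) = −Δ(θ(Δ(d x))); that is, Δ is a cochain map from (D•, −D) to (C•, d), where D := θ∘Δ∘d and D• := range(θ∘Δ). -/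
/-- If `d`, `Δ`, `θ` are linear endomorphisms of a module `M` over a commutative ring `R`
with `d ∘ d = 0`, `Δ ∘ Δ = 0`, `d ∘ Δ + Δ ∘ d = 0` and `θ ∘ Δ + Δ ∘ θ = id`, then for every
`x ∈ range (θ ∘ Δ)` one has `d (Δ x) = -Δ (θ (Δ (d x)))`: the map `Δ` is a cochain map
from `(range (θ ∘ Δ), -D)` to `(M, d)`, where `D := θ ∘ Δ ∘ d`. -/
theorem stmt5 {R M : Type*} [CommRing R] [AddCommGroup M] [Module R M]
    (d Δ θ : Module.End R M)
    (hd : d * d = 0) (hΔ : Δ * Δ = 0)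
    (hdΔ : d * Δ + Δ * d = 0) (hθΔ : θ * Δ + Δ * θ = 1) :
    ∀ x ∈ LinearMap.range (θ * Δ), d (Δ x) = -Δ (θ (Δ (d x))) := by
  intro x _
  have hΔθΔ : Δ (θ (Δ (d x))) = Δ (d x) := by
    have hid := congrArg Δ (LinearMap.congr_fun hθΔ (d x))
    have hsq : Δ (Δ (θ (d x))) = 0 := LinearMap.congr_fun hΔ (θ (d x))
    simpa [hsq] using hid
  rw [hΔθΔ]
  exact eq_neg_of_add_eq_zero_left (LinearMap.congr_fun hdΔ x)
end

section
/- Let M be a vector space over a field of characteristic zero and let d, Δ, θ, φ : M → M be linear maps satisfying d∘d = 0, Δ∘Δ = 0, d∘Δ + Δ∘d = 0, θ∘Δ + Δ∘θ = id, θ∘θ = 0, Δ = d∘φ − φ∘d, and φ∘θ = θ∘φ. Then for every natural number n and every x ∈ range(θ∘Δ) with (θ∘d)ⁿ x = 0, one has x ∈ range(θ∘d). -/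
/-- If `a * φ - φ * a` acts as a left identity on `a`, then
`aⁿ * φ * a = φ * aⁿ⁺¹ + n • aⁿ`. -/
theorem pow_mul_mul_of_commutator_mul_eq {R : Type*} [Ring R] {a φ p : R}
    (hcomm : a * φ = φ * a + p) (hpa : p * a = a) (n : ℕ) :
    a ^ n * (φ * a) = φ * a ^ (n + 1) + n * a ^ n := by
  induction n with
  | zero => simp
  | succ n ih =>
    have hp : p * a ^ (n + 1) = a ^ (n + 1) := by
      rw [pow_succ', ← mul_assoc, hpa]
    calc a ^ (n + 1) * (φ * a) = a * φ * a ^ (n + 1) + a * (n * a ^ n) := by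
          rw [pow_succ' a n, mul_assoc, ih, mul_add, ← pow_succ' a n, mul_assoc a φ]
      _ = φ * a ^ (n + 1 + 1) + p * a ^ (n + 1) + n * a ^ (n + 1) := by
          rw [hcomm, add_mul, mul_assoc, ← pow_succ', ← mul_assoc a, ← Nat.cast_comm, mul_assoc,
            ← pow_succ']
      _ = φ * a ^ (n + 1 + 1) + (n + 1 : ℕ) * a ^ (n + 1) := by
          rw [hp, Nat.cast_succ, add_mul, one_mul]
          abel

/-- If the commutator `p` of `a` and `φ` fixes the range of `a`, then every vector fixed by `p` and
killed by a power of `a` lies in the range of `a`. -/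
theorem mem_range_of_pow_apply_eq_zero_of_commutator {K M : Type*} [Field K] [CharZero K]
    [AddCommGroup M] [Module K M] {a φ p : Module.End K M}
    (hcomm : a * φ = φ * a + p) (hpa : p * a = a) (n : ℕ) {x : M} (hx : p x = x)
    (hn : (a ^ n) x = 0) : x ∈ LinearMap.range a := by
  induction n generalizing x with
  | zero =>
    obtain rfl : x = 0 := by simpa using hn
    exact zero_mem _
  | succ n ih =>
    have hax : a (φ x) = φ (a x) + x := by
      simpa [hx] using LinearMap.congr_fun hcomm x
    have hpow : (a ^ n) (φ (a x)) = (n : K) • (a ^ n) x := by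
      have := LinearMap.congr_fun (pow_mul_mul_of_commutator_mul_eq hcomm hpa n) x
      simpa [hn, Nat.cast_smul_eq_nsmul] using this
    have hpaφ : p (a (φ x)) = a (φ x) := LinearMap.congr_fun hpa (φ x)
    have hmem : ((n : K) + 1) • x - a (φ x) ∈ LinearMap.range a := by
      apply ih
      · rw [map_sub, map_smul, hx, hpaφ]
      · rw [hax, map_sub, map_smul, map_add, hpow]
        module
    have hsmul : ((n : K) + 1) • x ∈ LinearMap.range a := by
      simpa using add_mem hmem (LinearMap.mem_range_self a (φ x))
    exact (Submodule.smul_mem_iff _ (Nat.cast_add_one_ne_zero n)).1 hsmul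


/-- Lemma 4.1(2): Let `M` be a vector space over a field `K` of characteristic zero and let
`d`, `Δ`, `θ`, `φ` be linear endomorphisms of `M` with `d ∘ d = 0`, `Δ ∘ Δ = 0`,
`d ∘ Δ + Δ ∘ d = 0`, `θ ∘ Δ + Δ ∘ θ = id`, `θ ∘ θ = 0`, `Δ = d ∘ φ - φ ∘ d` and
`φ ∘ θ = θ ∘ φ`. Then for every natural number `n` and every `x ∈ range (θ ∘ Δ)` with
`(θ ∘ d)ⁿ x = 0`, one has `x ∈ range (θ ∘ d)`. -/
theorem stmt6 {K M : Type*} [Field K] [CharZero K] [AddCommGroup M] [Module K M]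
    (d Δ θ φ : Module.End K M)
    (hd : d * d = 0) (hΔ : Δ * Δ = 0)
    (hdΔ : d * Δ + Δ * d = 0) (hθΔ : θ * Δ + Δ * θ = 1)
    (hθ : θ * θ = 0) (hφ : Δ = d * φ - φ * d) (hφθ : φ * θ = θ * φ) :
    ∀ (n : ℕ), ∀ x ∈ LinearMap.range (θ * Δ),
      ((θ * d) ^ n) x = 0 → x ∈ LinearMap.range (θ * d) := by
  have hθΔθ : θ * Δ * θ = θ := by
    rw [eq_sub_of_add_eq hθΔ, sub_mul, mul_assoc, hθ, mul_zero, sub_zero, one_mul]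
  rintro n _ ⟨y, rfl⟩ hn
  refine mem_range_of_pow_apply_eq_zero_of_commutator (φ := φ) (p := θ * Δ) ?_ ?_ n ?_ hn
  · rw [← mul_assoc φ, hφθ, hφ]
    noncomm_ring
  · rw [← mul_assoc, hθΔθ]
  · rw [← Module.End.mul_apply, ← mul_assoc, hθΔθ]
end

section
/- Let V be a vector space over a field of characteristic zero and let A, B : V → V be linear maps with A∘B − B∘A = id. Then for every natural number n, ker(Aⁿ) ⊆ range(A). -/
theorem pow_mul_mul_of_commutator_eq_one {R : Type*} [Ring R] {a b : R}
    (h : a * b - b * a = 1) (n : ℕ) : a ^ n * (b * a) = (b * a + n) * a ^ n := by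
  induction n with
  | zero => simp
  | succ n ih =>
    have hab : a * b = b * a + 1 := by rw [← h]; abel
    calc a ^ (n + 1) * (b * a) = a * (b * a + n) * a ^ n := by
          rw [pow_succ', mul_assoc, ih, mul_assoc]
      _ = (b * a + (n + 1 : ℕ)) * a * a ^ n := by
          congr 1
          rw [mul_add, ← mul_assoc, hab, ← (n.cast_commute a).eq]
          push_cast
          noncomm_ring
      _ = (b * a + (n + 1 : ℕ)) * a ^ (n + 1) := by rw [mul_assoc, ← pow_succ']

/-- If `A`, `B` are linear endomorphisms of a vector space `V` over a field of
characteristic zero with `A ∘ B - B ∘ A = id`, then `ker (Aⁿ) ⊆ range A` for every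
natural number `n`. -/
theorem stmt7 {K V : Type*} [Field K] [CharZero K] [AddCommGroup V] [Module K V]
    (A B : Module.End K V) (h : A * B - B * A = 1) :
    ∀ n : ℕ, LinearMap.ker (A ^ n) ≤ LinearMap.range A := by
  intro n
  induction n with
  | zero => simp [Module.End.one_eq_id]
  | succ n ih =>
    intro v hv
    have hv' : A ((A ^ n) v) = 0 := by
      rwa [LinearMap.mem_ker, pow_succ', Module.End.mul_apply] at hv
    have hcomm : (A ^ n) (B (A v)) = (n : K) • (A ^ n) v := by
      simpa [hv', Nat.cast_smul_eq_nsmul] using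
        LinearMap.congr_fun (pow_mul_mul_of_commutator_eq_one h n) v
    obtain ⟨w, hw⟩ : B (A v) - (n : K) • v ∈ LinearMap.range A :=
      ih (by simp [hcomm])
    have hAB : A (B v) - B (A v) = v := LinearMap.congr_fun h v
    have hsmul : ((n + 1 : ℕ) : K) • v ∈ LinearMap.range A := by
      refine ⟨B v - w, ?_⟩
      rw [map_sub, hw, Nat.cast_succ, add_smul, one_smul, sub_eq_iff_eq_add.mp hAB]
      abel
    exact (Submodule.smul_mem_iff _ (Nat.cast_ne_zero.mpr n.succ_ne_zero)).mp hsmul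
end

section
/- Let V be a vector space over a field of characteristic zero and let A, B : V → V be linear maps with A∘B − B∘A = id. If x ∈ V satisfies Aⁿ x = 0 for some natural number n ≥ 1, then x = A( (Σ_{k=1}^{n} (1/k!) Bᵏ ∘ (−A)^{k−1}) x ). -/
/-- If `a * b - b * a = 1`, then the commutator of `a` with `b ^ (k + 1)` is `(k + 1) b ^ k`. -/
theorem mul_pow_succ_of_commutator_eq_one {R : Type*} [Ring R] {a b : R}
    (h : a * b - b * a = 1) (k : ℕ) :
    a * b ^ (k + 1) = b ^ (k + 1) * a + ((k + 1 : ℕ) : R) * b ^ k := by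
  have hab : a * b = b * a + 1 := by rw [← h]; abel
  induction k with
  | zero => simp [hab]
  | succ k ih =>
    rw [pow_succ b (k + 1), ← mul_assoc, ih, add_mul, mul_assoc _ a b, hab,
      mul_assoc _ (b ^ k) b, ← pow_succ, Nat.cast_succ (k + 1)]
    noncomm_ring

/-- The truncated exponential sum is a right inverse of `a` up to a multiple of `a ^ n`. -/
theorem mul_sum_of_commutator_eq_one {K R : Type*} [Field K] [CharZero K] [Ring R] [Algebra K R]
    {a b : R} (h : a * b - b * a = 1) (n : ℕ) :
    a * ∑ k ∈ Finset.Icc 1 n, ((k.factorial : K)⁻¹) • (b ^ k * (-a) ^ (k - 1)) =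
      1 - ((n.factorial : K)⁻¹) • (b ^ n * (-a) ^ n) := by
  induction n with
  | zero => simp
  | succ n ih =>
    have hfac : (((n + 1).factorial : K)⁻¹) * ((n + 1 : ℕ) : K) = (n.factorial : K)⁻¹ := by
      have h₁ : ((n + 1 : ℕ) : K) ≠ 0 := Nat.cast_ne_zero.mpr n.succ_ne_zero
      rw [Nat.factorial_succ, Nat.cast_mul, mul_inv, mul_right_comm, inv_mul_cancel₀ h₁, one_mul]
    have hcast : ((n + 1 : ℕ) : R) * b ^ n = ((n + 1 : ℕ) : K) • b ^ n := by
      rw [Nat.cast_smul_eq_nsmul, nsmul_eq_mul]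
    rw [Finset.sum_Icc_succ_top (Nat.le_add_left 1 n), mul_add, ih, mul_smul_comm, ← mul_assoc,
      mul_pow_succ_of_commutator_eq_one h, Nat.add_sub_cancel, add_mul, hcast, smul_mul_assoc,
      smul_add, smul_smul, hfac, pow_succ' (-a) n, neg_mul, mul_neg, smul_neg, mul_assoc]
    abel

/-- If `A`, `B` are linear endomorphisms of a vector space `V` over a field of
characteristic zero with `A ∘ B - B ∘ A = id`, and `x ∈ V` satisfies `Aⁿ x = 0` for some
`n ≥ 1`, then `x = A ((∑_{k=1}^{n} (1/k!) Bᵏ ∘ (-A)^(k-1)) x)`. -/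
theorem stmt8 {K V : Type*} [Field K] [CharZero K] [AddCommGroup V] [Module K V]
    (A B : Module.End K V) (h : A * B - B * A = 1)
    (n : ℕ) (hn : 1 ≤ n) (x : V) (hx : (A ^ n) x = 0) :
    x = A ((∑ k ∈ Finset.Icc 1 n, ((k.factorial : K)⁻¹) • (B ^ k * (-A) ^ (k - 1))) x) := by
  rw [← Module.End.mul_apply, mul_sum_of_commutator_eq_one h, neg_pow]
  rcases neg_one_pow_eq_or (Module.End K V) n with hs | hs <;> simp [hs, hx]
end

section
/- Let K be a field of characteristic zero, let U be a K-vector space, and let N : U → U be a linear map with N^m = 0 for some natural number m ≥ 1. If P is a polynomial with coefficients in U (an element of the polynomial module U[t]) satisfying P′ + N·P = 0, where P′ is the formal derivative and N·P means N applied to each coefficient of P, then every coefficient of P in degree ≥ m vanishes; in particular, if P ≠ 0 then deg P ≤ m − 1. -/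
/-- A sequence solving `(i+1) • p (i+1) + N (p i) = 0` is, term by term, a scalar multiple of the
orbit of `p 0` under `N`. -/
theorem exists_eq_smul_pow_apply_of_succ_smul_add_eq_zero {K U : Type*} [Field K] [CharZero K]
    [AddCommGroup U] [Module K U] (N : U →ₗ[K] U) (p : ℕ → U)
    (hp : ∀ i : ℕ, ((i : K) + 1) • p (i + 1) + N (p i) = 0) (i : ℕ) :
    ∃ c : K, p i = c • (N ^ i) (p 0) := by
  induction i with
  | zero => exact ⟨1, by simp⟩
  | succ i ih =>
    obtain ⟨c, hc⟩ := ih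
    have hne : (i : K) + 1 ≠ 0 := Nat.cast_add_one_ne_zero i
    refine ⟨((i : K) + 1)⁻¹ * -c, ?_⟩
    rw [mul_smul, eq_inv_smul_iff₀ hne, eq_neg_of_add_eq_zero_left (hp i), hc, map_smul,
      pow_succ', Module.End.mul_apply, neg_smul]

/-- Let `K` be a field of characteristic zero, `U` a `K`-vector space, and `N : U → U`
a linear map with `N ^ m = 0` for some `m ≥ 1`. If `P` is a polynomial with coefficients
in `U` (encoded as the finitely supported family `P : ℕ →₀ U` of its coefficients)
satisfying `P′ + N·P = 0` (coefficientwise: `(i+1) • P (i+1) + N (P i) = 0` for every `i`),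
then every coefficient of `P` in degree `≥ m` vanishes. -/
theorem stmt10 {K U : Type*} [Field K] [CharZero K] [AddCommGroup U] [Module K U]
    (N : U →ₗ[K] U) (m : ℕ) (hm : 1 ≤ m) (hN : N ^ m = 0)
    (P : ℕ →₀ U) (hP : ∀ i : ℕ, ((i : K) + 1) • P (i + 1) + N (P i) = 0) :
    ∀ i : ℕ, m ≤ i → P i = 0 := by
  intro i hi
  obtain ⟨c, hc⟩ := exists_eq_smul_pow_apply_of_succ_smul_add_eq_zero N P hP i
  rw [hc, pow_eq_zero_of_le hi hN, LinearMap.zero_apply, smul_zero]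
end
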